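/- There do not exist n ≥ 1, an n×n real matrix A, vectors b, c, z₀ ∈ ℝⁿ, and differentiable functions z_a, z_b, z_c : ℝ → ℝⁿ satisfying z_a'(t) = A z_a(t) + (−1)·b, z_b'(t) = A z_b(t) + (−3)·b, z_c'(t) = A z_c(t) + (1)·b for all t ≥ 0, with z_a(0) = z_b(0) = z_c(0) = z₀, such that cᵀ z_a(t) = e^{−t}, cᵀ z_b(t) = e^{−3t}, and cᵀ z_c(t) = e^{t} for all t ≥ 0. -/

import Mathlib

open Matrix

/-- Example 2.1: no lifted LTI model of any finite dimension can reproduce the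
outputs `e^{−t}, e^{−3t}, e^{t}` of the bilinear system `ẋ = ux, x(0) = 1, y = x`
under the constant inputs `u ≡ −1, −3, 1`. -/
theorem no_lifted_lti_model :
    ¬ ∃ (n : ℕ) (A : Matrix (Fin n) (Fin n) ℝ) (b c z₀ : Fin n → ℝ)
        (za zb zc : ℝ → Fin n → ℝ),
      1 ≤ n ∧
      (∀ t : ℝ, 0 ≤ t → HasDerivAt za (A.mulVec (za t) + (-1 : ℝ) • b) t) ∧
      (∀ t : ℝ, 0 ≤ t → HasDerivAt zb (A.mulVec (zb t) + (-3 : ℝ) • b) t) ∧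
      (∀ t : ℝ, 0 ≤ t → HasDerivAt zc (A.mulVec (zc t) + (1 : ℝ) • b) t) ∧
      za 0 = z₀ ∧ zb 0 = z₀ ∧ zc 0 = z₀ ∧
      (∀ t : ℝ, 0 ≤ t → c ⬝ᵥ za t = Real.exp (-t)) ∧
      (∀ t : ℝ, 0 ≤ t → c ⬝ᵥ zb t = Real.exp (-3 * t)) ∧
      (∀ t : ℝ, 0 ≤ t → c ⬝ᵥ zc t = Real.exp t) := by
  rintro ⟨n, A, b, c, z₀, za, zb, zc, -, ha, hb, hc, ha0, hb0, hc0, ya, yb, yc⟩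
  let L : (Fin n → ℝ) →L[ℝ] (Fin n → ℝ) := LinearMap.toContinuousLinearMap (Matrix.mulVecLin A)
  have hL : ∀ v, L v = A.mulVec v := fun v => rfl
  let w : ℝ → Fin n → ℝ := fun t => (2 : ℝ) • za t - zb t - zc t
  have hw : ∀ t : ℝ, 0 ≤ t → HasDerivAt w (L (w t)) t := by
    intro t ht
    have h := (((ha t ht).const_smul (2 : ℝ)).sub (hb t ht)).sub (hc t ht)
    refine HasDerivAt.congr_deriv h ?_
    simp only [w, hL, Matrix.mulVec_sub, Matrix.mulVec_smul]
    module
  have key : Set.EqOn w (fun _ => 0) (Set.Icc 0 1) := by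
    apply ODE_solution_unique (v := fun _ x => L x) (K := ‖L‖₊)
    · intro t
      exact L.lipschitz
    · exact fun t ht => (hw t ht.1).continuousAt.continuousWithinAt
    · exact fun t ht => (hw t ht.1).hasDerivWithinAt
    · exact continuousOn_const
    · intro t _
      simpa using hasDerivWithinAt_const t (Set.Ici t) (0 : Fin n → ℝ)
    · simp only [w, ha0, hb0, hc0]
      module
  have h1 : w 1 = 0 := key (by simp)
  have h2 : c ⬝ᵥ w 1 = 0 := by rw [h1]; simp
  simp only [w, dotProduct_sub, dotProduct_smul, ya 1 zero_le_one, yb 1 zero_le_one,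
    yc 1 zero_le_one, smul_eq_mul] at h2
  have e1 : Real.exp (-1) < 1 := by
    rw [Real.exp_lt_one_iff]; norm_num
  have e2 := Real.exp_pos (-3 * 1)
  have e3 : (2 : ℝ) < Real.exp 1 := by
    have := Real.exp_one_gt_d9
    linarith
  linarith
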